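/- Let R be a commutative ring and n ≥ 1 an integer. Let w ∈ M_n(R) be the antidiagonal matrix (w_{i,j} = 1 if i + j = n + 1 and 0 otherwise) and let u ∈ GL_{2n}(R) be the block matrix [[1_n, 0],[w, 1_n]]. Then for A, B ∈ M_n(R), the matrix u^{-1}·diag(A,B)·u is upper triangular if and only if there exist y_1, …, y_n ∈ R such that A = diag(y_1, …, y_n) and B = diag(y_n, …, y_1). -/

import Mathlib

/- We index `2n × 2n` matrices by `Fin n ⊕ Fin n` (two blocks of size `n`), with
`ordIdx` giving the usual linear ordering of the `2n` coordinates. -/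

/-- The position of an index of `Fin n ⊕ Fin n` in the usual ordering `0, …, 2n−1`. -/
def ordIdx (n : ℕ) : Fin n ⊕ Fin n → ℕ :=
  Sum.elim (fun a => (a : ℕ)) (fun a => n + (a : ℕ))

/-- The `n × n` antidiagonal matrix `w` over `R` (0-based: `w i j = 1` iff
`i + j + 1 = n`, i.e. 1-based `i + j = n + 1`). -/
def wMat (R : Type*) [CommRing R] (n : ℕ) : Matrix (Fin n) (Fin n) R :=
  fun i j => if (i : ℕ) + (j : ℕ) + 1 = n then 1 else 0

/-- The element `u = [[1_n, 0], [w, 1_n]] ∈ GL_{2n}(R)`. -/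
def uMat (R : Type*) [CommRing R] (n : ℕ) :
    Matrix (Fin n ⊕ Fin n) (Fin n ⊕ Fin n) R :=
  Matrix.fromBlocks 1 0 (wMat R n) 1

/-- The block diagonal matrix `diag(A, B)`. -/
def blockDiag (R : Type*) [CommRing R] (n : ℕ) (A B : Matrix (Fin n) (Fin n) R) :
    Matrix (Fin n ⊕ Fin n) (Fin n ⊕ Fin n) R :=
  Matrix.fromBlocks A 0 0 B

theorem wMat_eq_rev (R : Type*) [CommRing R] (n : ℕ) (i j : Fin n) :
    wMat R n i j = if j = i.rev then 1 else 0 := by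
  have h : ((i : ℕ) + (j : ℕ) + 1 = n) ↔ j = i.rev := by
    rw [Fin.ext_iff, Fin.val_rev]; omega
  simp only [wMat, h]

theorem wMat_eq_rev_left (R : Type*) [CommRing R] (n : ℕ) (i j : Fin n) :
    wMat R n i j = if i = j.rev then 1 else 0 := by
  have h : ((i : ℕ) + (j : ℕ) + 1 = n) ↔ i = j.rev := by
    rw [Fin.ext_iff, Fin.val_rev]; omega
  simp only [wMat, h]

theorem uMat_inv (R : Type*) [CommRing R] (n : ℕ) :
    (uMat R n)⁻¹ = Matrix.fromBlocks 1 0 (-wMat R n) 1 := by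
  apply Matrix.inv_eq_left_inv
  simp [uMat, Matrix.fromBlocks_multiply]

theorem conj_eq (R : Type*) [CommRing R] (n : ℕ) (A B : Matrix (Fin n) (Fin n) R) :
    (uMat R n)⁻¹ * blockDiag R n A B * uMat R n =
      Matrix.fromBlocks A 0 (Matrix.of fun i j => B i j.rev - A i.rev j) B := by
  have h : -(wMat R n * A) + B * wMat R n = Matrix.of fun i j => B i j.rev - A i.rev j := by
    ext i j
    have h1 : (wMat R n * A) i j = A i.rev j := by
      simp [Matrix.mul_apply, wMat_eq_rev]
    have h2 : (B * wMat R n) i j = B i j.rev := by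
      simp [Matrix.mul_apply, wMat_eq_rev_left]
    rw [Matrix.add_apply, Matrix.neg_apply, h1, h2, Matrix.of_apply]; ring
  rw [uMat_inv, ← h]
  simp [uMat, blockDiag, Matrix.fromBlocks_multiply]

/-- Over any commutative ring `R`, `u⁻¹·diag(A,B)·u` is upper
triangular iff `A = diag(y_1, …, y_n)` and `B = diag(y_n, …, y_1)` for some
`y_1, …, y_n ∈ R`. -/
theorem stmt8 (R : Type*) [CommRing R] (n : ℕ) (hn : 1 ≤ n)
    (A B : Matrix (Fin n) (Fin n) R) :
    (∀ i j : Fin n ⊕ Fin n, ordIdx n j < ordIdx n i →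
      ((uMat R n)⁻¹ * blockDiag R n A B * uMat R n) i j = 0) ↔
    (∃ y : Fin n → R, A = Matrix.diagonal y ∧ B = Matrix.diagonal (fun i => y i.rev)) := by
  rw [conj_eq]
  constructor
  · intro h
    have hA : ∀ i j : Fin n, j < i → A i j = 0 := fun i j hij => by
      simpa using h (Sum.inl i) (Sum.inl j) (by simpa [ordIdx] using hij)
    have hB : ∀ i j : Fin n, j < i → B i j = 0 := fun i j hij => by
      simpa using h (Sum.inr i) (Sum.inr j) (by simpa [ordIdx] using hij)
    have hC : ∀ i j : Fin n, B i j = A i.rev j.rev := fun i j => by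
      have := h (Sum.inr i) (Sum.inl j.rev) (by simp [ordIdx]; omega)
      simpa [sub_eq_zero] using this
    have hd : ∀ i j : Fin n, i ≠ j → A i j = 0 := fun i j hij => by
      rcases lt_or_gt_of_ne hij with hl | hl
      · have := hB i.rev j.rev (by simpa using hl)
        rw [hC] at this
        simpa using this
      · exact hA i j hl
    refine ⟨fun i => A i i, ?_, ?_⟩
    · ext i j
      by_cases hij : i = j
      · subst hij; simp
      · rw [Matrix.diagonal_apply_ne _ hij, hd i j hij]
    · ext i j
      rw [hC]
      by_cases hij : i = j
      · subst hij; simp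
      · rw [Matrix.diagonal_apply_ne _ hij, hd _ _ (by simpa using hij)]
  · rintro ⟨y, rfl, rfl⟩ (i | i) (j | j) hij
    · have : i ≠ j := by rintro rfl; simp at hij
      simp [this]
    · simp
    · rw [Matrix.fromBlocks_apply₂₁, Matrix.of_apply]
      by_cases hk : i.rev = j
      · subst hk; simp
      · have : i ≠ j.rev := by rintro rfl; simp at hk
        simp [Matrix.diagonal_apply_ne _ hk, Matrix.diagonal_apply_ne _ this]
    · have : i ≠ j := by rintro rfl; simp at hij
      simp [this]
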